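/- Let d, N ≥ 1, λ > 0, Q > 0, and let φ_1, …, φ_N ∈ ℝ^d satisfy ‖φ_n‖₂ ≤ Q for every n. Define V_0 = λ I_d and V_n = V_{n−1} + φ_n φ_nᵀ for n ≥ 1. Then ∑_{n=1}^N min(1, ‖φ_n‖_{V_{n−1}⁻¹}) ≤ √( 2 N d log(1 + N Q² / (λ d)) ), where ‖x‖_A := √(xᵀ A x). -/

import Mathlib

open scoped Matrix

/-- The weighted norm `‖x‖_A := √(xᵀ A x)` associated to a (positive definite) matrix `A`. -/
noncomputable def wnorm {d : ℕ} (A : Matrix (Fin d) (Fin d) ℝ) (x : Fin d → ℝ) : ℝ :=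
  Real.sqrt (x ⬝ᵥ A.mulVec x)

open Matrix in
lemma aux_det {d : ℕ} (A : Matrix (Fin d) (Fin d) ℝ) (hA : A.PosDef) (u : Fin d → ℝ) :
    (A + vecMulVec u u).det = A.det * (1 + u ⬝ᵥ A⁻¹ *ᵥ u) := by
  have hu : IsUnit A.det := hA.det_pos.ne'.isUnit
  rw [vecMulVec_eq Unit, det_add_replicateCol_mul_replicateRow hu]
  congr 1
  rw [det_unique, Matrix.add_apply, Matrix.one_apply_eq, Matrix.mul_assoc,
    ← Matrix.replicateCol_mulVec, Matrix.replicateRow_mul_replicateCol_apply]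

lemma aux_logdet {d : ℕ} (A : Matrix (Fin d) (Fin d) ℝ) (hA : A.PosDef) (c : ℝ) (hc : 0 < c)
    (ht : A.trace ≤ d * c) : Real.log A.det ≤ d * Real.log c := by
  have h1 := hA.isHermitian.det_eq_prod_eigenvalues
  have h2 := hA.isHermitian.trace_eq_sum_eigenvalues
  simp only [RCLike.ofReal_real_eq_id, id] at h1 h2
  rw [h1, Real.log_prod (fun i _ => (hA.eigenvalues_pos i).ne')]
  have h3 : ∀ i ∈ (Finset.univ : Finset (Fin d)), Real.log (hA.isHermitian.eigenvalues i) ≤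
      Real.log c + (hA.isHermitian.eigenvalues i / c - 1) := by
    intro i _
    have hp := hA.eigenvalues_pos i
    have := Real.log_le_sub_one_of_pos (div_pos hp hc)
    rw [Real.log_div hp.ne' hc.ne'] at this
    linarith
  refine (Finset.sum_le_sum h3).trans ?_
  rw [Finset.sum_add_distrib, Finset.sum_sub_distrib, ← Finset.sum_div, ← h2]
  have : A.trace / c ≤ d := by rwa [div_le_iff₀ hc]
  simp
  linarith

lemma aux_min (x : ℝ) (hx : 0 ≤ x) : (min 1 (Real.sqrt x)) ^ 2 ≤ 2 * Real.log (1 + x) := by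
  have h := Real.one_sub_inv_le_log_of_pos (show 0 < 1 + x by linarith)
  have h1 : 1 - (1 + x)⁻¹ = x / (1 + x) := by field_simp; ring
  rw [h1] at h
  refine le_trans ?_ (mul_le_mul_of_nonneg_left h (by norm_num : (0:ℝ) ≤ 2))
  rw [← mul_div_assoc, le_div_iff₀ (by linarith)]
  have hs := Real.sq_sqrt hx
  have hs0 := Real.sqrt_nonneg x
  rcases le_total 1 (Real.sqrt x) with h | h
  · rw [min_eq_left h]; nlinarith
  · have hx1 : x ≤ 1 := by nlinarith
    rw [min_eq_right h, hs]; nlinarith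

/-- Let `d, N ≥ 1`, `λ > 0`, `Q > 0`, and let `φ_1, …, φ_N ∈ ℝ^d` satisfy
`‖φ_n‖₂ ≤ Q` for every `n`. With `V_0 = λ I_d` and `V_n = V_{n−1} + φ_n φ_nᵀ`, we have
`∑_{n=1}^N min(1, ‖φ_n‖_{V_{n−1}⁻¹}) ≤ √(2 N d log(1 + N Q² / (λ d)))`.
(Here `φ (n : Fin N)` is the `(n+1)`-th feature vector, so it is paired with `V n`.) -/
theorem sum_min_one_weighted_norm_le
    (d N : ℕ) (hd : 1 ≤ d) (hN : 1 ≤ N) (lam Q : ℝ) (hlam : 0 < lam) (hQ : 0 < Q)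
    (φ : Fin N → Fin d → ℝ) (hφ : ∀ n, Real.sqrt (φ n ⬝ᵥ φ n) ≤ Q)
    (V : ℕ → Matrix (Fin d) (Fin d) ℝ)
    (hV0 : V 0 = lam • (1 : Matrix (Fin d) (Fin d) ℝ))
    (hVs : ∀ n : Fin N, V (n + 1) = V n + Matrix.vecMulVec (φ n) (φ n)) :
    ∑ n : Fin N, min 1 (wnorm (V n)⁻¹ (φ n)) ≤
      Real.sqrt (2 * N * d * Real.log (1 + N * Q ^ 2 / (lam * d))) := by
  have key : ∀ k : ℕ, k ≤ N → (V k).PosDef ∧ (V k).trace ≤ lam * d + k * Q ^ 2 := by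
    intro k
    induction k with
    | zero =>
      intro _
      rw [hV0]
      exact ⟨Matrix.PosDef.one.smul hlam, by simp⟩
    | succ k ih =>
      intro hk
      obtain ⟨h1, h2⟩ := ih (by omega)
      have hv := hVs ⟨k, hk⟩
      simp only at hv
      rw [hv]
      refine ⟨h1.add_posSemidef ?_, ?_⟩
      · simpa using Matrix.posSemidef_vecMulVec_self_star (φ ⟨k, hk⟩)
      · rw [Matrix.trace_add, Matrix.trace_vecMulVec]
        have := (Real.sqrt_le_left hQ.le).1 (hφ ⟨k, hk⟩)
        push_cast
        linarith
  have hd0 : (0:ℝ) < d := by exact_mod_cast hd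
  have hN0 : (0:ℝ) < N := by exact_mod_cast hN
  have hstep : ∀ n : Fin N, (min 1 (wnorm (V n)⁻¹ (φ n))) ^ 2 ≤
      2 * (Real.log (V (n + 1)).det - Real.log (V n).det) := by
    intro n
    have hp := (key n n.2.le).1
    have hx : 0 ≤ φ n ⬝ᵥ (V n)⁻¹ *ᵥ φ n := by
      simpa using hp.inv.posSemidef.dotProduct_mulVec_nonneg (φ n)
    rw [hVs n, aux_det _ hp, Real.log_mul hp.det_pos.ne' (by linarith), add_sub_cancel_left]
    exact aux_min _ hx
  have hsum : ∑ n : Fin N, (min 1 (wnorm (V n)⁻¹ (φ n))) ^ 2 ≤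
      2 * d * Real.log (1 + N * Q ^ 2 / (lam * d)) := by
    refine (Finset.sum_le_sum fun n _ => hstep n).trans ?_
    rw [← Finset.mul_sum, Fin.sum_univ_eq_sum_range
      (fun i => Real.log (V (i + 1)).det - Real.log (V i).det) N,
      Finset.sum_range_sub (fun i => Real.log (V i).det)]
    have h0 : Real.log (V 0).det = d * Real.log lam := by
      rw [hV0]; simp
    have hc : 0 < 1 + N * Q ^ 2 / (lam * d) := by positivity
    have h1 := aux_logdet (V N) (key N le_rfl).1 (lam * (1 + N * Q ^ 2 / (lam * d)))
      (by positivity) ((key N le_rfl).2.trans_eq (by field_simp))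
    rw [Real.log_mul hlam.ne' hc.ne'] at h1
    rw [h0]
    linarith
  apply Real.le_sqrt_of_sq_le
  refine sq_sum_le_card_mul_sum_sq.trans ?_
  rw [Finset.card_univ, Fintype.card_fin]
  refine (mul_le_mul_of_nonneg_left hsum hN0.le).trans_eq (by ring)
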